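/- Let φ, ψ ∈ L²(ℝⁿ) and let F = T_d(φ, ψ). If the set {v ∈ ℝ²ⁿ : F(v) ≠ 0} has finite Lebesgue measure, then F vanishes identically. -/

import Mathlib

open MeasureTheory Complex

noncomputable section

/-- ℝⁿ with the Euclidean structure. -/
abbrev En (n : ℕ) := EuclideanSpace ℝ (Fin n)

/-- The representation π_d(x,y) acting on functions:
`(π_d(x,y)φ)(ξ) = exp(i ∑_j d_j (x_j ξ_j + (1/2) x_j y_j)) φ(ξ + y)`. -/
def piD {n : ℕ} (d : Fin n → ℝ) (x y : En n) (φ : En n → ℂ) : En n → ℂ :=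
  fun ξ =>
    Complex.exp (Complex.I *
      ((∑ j, d j * (x j * ξ j + (1 / 2) * (x j * y j)) : ℝ) : ℂ)) * φ (ξ + y)

/-- The Fourier–Wigner transform `T_d(φ,ψ)(x,y) = ⟨π_d(x,y)φ, ψ⟩`, with the
inner product `⟨u,v⟩ = ∫ u(ξ) conj(v(ξ)) dξ`. -/
def Td {n : ℕ} (d : Fin n → ℝ) (φ ψ : En n → ℂ) (v : En n × En n) : ℂ :=
  ∫ ξ : En n, piD d v.1 v.2 φ ξ * (starRingEnd ℂ) (ψ ξ)



def eC {ι : Type*} [Fintype ι] (w z : ι → ℝ) : ℂ :=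
  Complex.exp (((2 * Real.pi * ∑ i, w i * z i : ℝ) : ℂ) * Complex.I)

section
set_option linter.unusedSectionVars false
variable {ι : Type*} [Fintype ι]

lemma eC_add_left (a b z : ι → ℝ) : eC (a + b) z = eC a z * eC b z := by
  unfold eC
  rw [← Complex.exp_add, ← add_mul, ← Complex.ofReal_add]
  congr 3
  simp only [Pi.add_apply, add_mul, Finset.sum_add_distrib]; ring

lemma eC_add_right (a z y : ι → ℝ) : eC a (z + y) = eC a z * eC a y := by
  unfold eC
  rw [← Complex.exp_add, ← add_mul, ← Complex.ofReal_add]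
  congr 3
  simp only [Pi.add_apply, mul_add, Finset.sum_add_distrib]

lemma eC_zero_left (z : ι → ℝ) : eC 0 z = 1 := by simp [eC]

lemma eC_norm (a z : ι → ℝ) : ‖eC a z‖ = 1 := by
  unfold eC; exact Complex.norm_exp_ofReal_mul_I _

lemma eC_conj (a z : ι → ℝ) : (starRingEnd ℂ) (eC a z) = eC (-a) z := by
  unfold eC
  rw [← Complex.exp_conj]
  congr 1
  rw [map_mul, Complex.conj_ofReal, Complex.conj_I]
  simp only [Pi.neg_apply, neg_mul, Finset.sum_neg_distrib, mul_neg, Complex.ofReal_neg]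

lemma eC_cont (a : ι → ℝ) : Continuous (eC a) := by
  unfold eC; fun_prop

lemma eC_cont2 : Continuous (fun p : (ι → ℝ) × (ι → ℝ) => eC p.1 p.2) := by
  unfold eC; fun_prop

/-- integer frequency -/
def zv (l : ι → ℤ) : ι → ℝ := fun i => (l i : ℝ)

def qT (z : ι → ℝ) : UnitAddTorus ι := fun i => (z i : UnitAddCircle)

lemma qT_cont : Continuous (qT : (ι → ℝ) → UnitAddTorus ι) := by
  unfold qT
  refine continuous_pi fun i => ?_
  exact (AddCircle.continuous_mk' (1:ℝ)).comp (continuous_apply i)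

lemma mFourier_qT (l : ι → ℤ) (z : ι → ℝ) :
    UnitAddTorus.mFourier l (qT z) = eC (zv l) z := by
  simp only [UnitAddTorus.mFourier, qT, ContinuousMap.coe_mk, fourier_coe_apply, eC, zv]
  rw [← Complex.exp_sum]
  congr 1
  push_cast
  rw [Finset.mul_sum, Finset.sum_mul]
  refine Finset.sum_congr rfl fun i _ => ?_
  ring

def cell (ι : Type*) [Fintype ι] : Set (ι → ℝ) := ZSpan.fundamentalDomain (Pi.basisFun ℝ ι)

lemma cell_eq : cell ι = Set.pi Set.univ fun _ : ι ↦ Set.Ico (0 : ℝ) 1 :=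
  ZSpan.fundamentalDomain_pi_basisFun

lemma cell_vol : volume (cell ι) = 1 := by
  rw [cell_eq, Real.volume_pi_Ico]; simp

lemma cell_meas : MeasurableSet (cell ι) := ZSpan.fundamentalDomain_measurableSet _

lemma orth1 (k : ℤ) (hk : k ≠ 0) : ∫ t in Set.Ico (0:ℝ) 1, Complex.exp (((2 * Real.pi * (k * t) : ℝ) : ℂ) * Complex.I) = 0 := by
  rw [integral_Ico_eq_integral_Ioc, ← intervalIntegral.integral_of_le zero_le_one]
  have hc : (2 * Real.pi * k * Complex.I : ℂ) ≠ 0 := by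
    simp [hk, Real.pi_ne_zero]
  have := integral_exp_mul_complex (a := 0) (b := 1) hc
  have h2 : ∀ t : ℝ, Complex.exp (((2 * Real.pi * (k * t) : ℝ) : ℂ) * Complex.I) = Complex.exp ((2 * Real.pi * k * Complex.I : ℂ) * t) := by
    intro t; congr 1; push_cast; ring
  simp_rw [h2]
  rw [this]
  have : Complex.exp ((2 * Real.pi * k * Complex.I : ℂ) * (1:ℝ)) = 1 := by
    rw [Complex.exp_eq_one_iff]; exact ⟨k, by push_cast; ring⟩
  rw [this]; simp

lemma orth (l : ι → ℤ) : ∫ z in cell ι, eC (zv l) z = if l = 0 then 1 else 0 := by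
  split_ifs with h
  · subst h
    have : zv (0 : ι → ℤ) = 0 := by ext; simp [zv]
    simp [this, eC_zero_left, Measure.real, cell_vol]
  · obtain ⟨i, hi⟩ := Function.ne_iff.mp h
    have h1 : ∀ z : ι → ℝ, eC (zv l) z = ∏ i, Complex.exp (((2 * Real.pi * (l i * z i) : ℝ) : ℂ) * Complex.I) := by
      intro z
      rw [← Complex.exp_sum, ← Finset.sum_mul, ← Complex.ofReal_sum, ← Finset.mul_sum]
      rfl
    simp_rw [h1]
    rw [cell_eq, volume_pi, Measure.restrict_pi_pi,
      integral_fintype_prod_eq_prod (fun i t => Complex.exp (((2 * Real.pi * (l i * t) : ℝ) : ℂ) * Complex.I))]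
    exact Finset.prod_eq_zero (Finset.mem_univ i) (orth1 _ hi)

lemma exists_sep (F : Finset (ι → ℤ)) : ∃ v : ι → ℝ, ∀ l ∈ F, ∀ l' ∈ F, l ≠ l' →
    ∑ i, (l i : ℝ) * v i ≠ ∑ i, (l' i : ℝ) * v i := by
  have key : ∀ k : ι → ℤ, k ≠ 0 → ∀ᵐ v : ι → ℝ, ∑ i, (k i : ℝ) * v i ≠ 0 := by
    intro k hk
    let φ : (ι → ℝ) →ₗ[ℝ] ℝ := ∑ i, (k i : ℝ) • LinearMap.proj i
    have hφ : ∀ v, φ v = ∑ i, (k i : ℝ) * v i := by intro v; simp [φ]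
    have : volume ((LinearMap.ker φ : Submodule ℝ (ι → ℝ)) : Set (ι → ℝ)) = 0 := by
      apply Measure.addHaar_submodule
      intro h
      obtain ⟨i, hi⟩ := Function.ne_iff.mp hk
      classical
      have h2 : φ (Pi.single i 1) = 0 := by
        have : (Pi.single i 1 : ι → ℝ) ∈ LinearMap.ker φ := by rw [h]; trivial
        exact this
      rw [hφ] at h2
      simp [Pi.single_apply] at h2
      exact hi h2
    rw [ae_iff]
    convert this using 2
    ext v; simp [hφ]
  have h2 : ∀ᵐ v : ι → ℝ, ∀ l ∈ F, ∀ l' ∈ F, l ≠ l' →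
      ∑ i, (l i : ℝ) * v i ≠ ∑ i, (l' i : ℝ) * v i := by
    rw [ae_all_iff]; intro l
    rw [Filter.eventually_imp_distrib_left]; intro _
    rw [ae_all_iff]; intro l'
    rw [Filter.eventually_imp_distrib_left]; intro _
    rw [Filter.eventually_imp_distrib_left]; intro h
    filter_upwards [key (l - l') (sub_ne_zero.mpr h)] with v hv h3
    apply hv
    simp only [Pi.sub_apply, Int.cast_sub, sub_mul, Finset.sum_sub_distrib, h3, sub_self]
  exact h2.exists

def chR (a : ℝ) : Multiplicative ℝ →* ℂ where
  toFun t := Complex.exp ((a * t.toAdd : ℝ) * Complex.I)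
  map_one' := by simp
  map_mul' s t := by
    rw [← Complex.exp_add, ← add_mul, ← Complex.ofReal_add, toAdd_mul, mul_add]

lemma chR_inj : Function.Injective chR := by
  intro a b h
  have h1 : (fun t : ℝ => Complex.exp ((a * t : ℝ) * Complex.I)) = fun t : ℝ => Complex.exp ((b * t : ℝ) * Complex.I) := by
    ext t; exact DFunLike.congr_fun h (Multiplicative.ofAdd t)
  have hd : ∀ c : ℝ, HasDerivAt (fun t : ℝ => Complex.exp ((c * t : ℝ) * Complex.I)) (c * Complex.I) 0 := by
    intro c
    have h0 : HasDerivAt (fun t : ℝ => ((c * t : ℝ) : ℂ) * Complex.I) (c * Complex.I) 0 := by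
      have := (((hasDerivAt_id (0:ℝ)).const_mul c).ofReal_comp).mul_const Complex.I
      simpa using this
    simpa using h0.cexp
  have := (hd a).unique (h1 ▸ hd b)
  simpa using this

lemma trig_null1 {κ : Type*} (F : Finset κ) (a : κ → ℝ) (c : κ → ℂ)
    (ha : ∀ l ∈ F, ∀ l' ∈ F, l ≠ l' → a l ≠ a l') (hc : ∃ l ∈ F, c l ≠ 0) :
    ∀ᵐ t : ℝ, ∑ l ∈ F, c l * Complex.exp ((a l * t : ℝ) * Complex.I) ≠ 0 := by
  have han : AnalyticOnNhd ℝ (fun t : ℝ => ∑ l ∈ F, c l * Complex.exp ((a l * t : ℝ) * Complex.I)) Set.univ := by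
    apply Finset.analyticOnNhd_fun_sum
    intro l _ t _
    apply AnalyticAt.mul analyticAt_const
    refine ((analyticAt_cexp (z := ((a l * t : ℝ) * Complex.I))).restrictScalars (𝕜 := ℝ)).comp
      (f := fun t : ℝ => ((a l * t : ℝ) : ℂ) * Complex.I) ?_
    refine AnalyticAt.mul ?_ analyticAt_const
    exact (Complex.ofRealCLM.analyticAt _).comp (f := fun t : ℝ => a l * t) (analyticAt_const.mul analyticAt_id)
  rcases han.eqOn_zero_or_eventually_ne_zero_of_preconnected isPreconnected_univ with h | h
  · exfalso
    have hli := (linearIndependent_monoidHom (Multiplicative ℝ) ℂ)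
    have hli2 : LinearIndependent ℂ (fun l : F => (chR (a l) : Multiplicative ℝ → ℂ)) := by
      refine hli.comp (fun l : F => chR (a l)) ?_
      intro l l' hll
      by_contra hne
      exact ha l l.2 l' l'.2 (fun h => hne (Subtype.ext h)) (chR_inj hll)
    rw [Fintype.linearIndependent_iff] at hli2
    obtain ⟨l, hl, hcl⟩ := hc
    apply hcl
    refine hli2 (fun l => c l) ?_ ⟨l, hl⟩
    ext t
    have := h (Set.mem_univ t.toAdd)
    simp only [Finset.sum_apply, Pi.smul_apply, smul_eq_mul, Pi.zero_apply]
    rw [Finset.univ_eq_attach, Finset.sum_attach F (fun l => c l * chR (a l) t)]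
    exact this
  · have := ae_restrict_le_codiscreteWithin (μ := (volume : Measure ℝ)) MeasurableSet.univ h
    rw [Measure.restrict_univ] at this
    exact this

lemma trig_null (F : Finset (ι → ℤ)) (c : (ι → ℤ) → ℂ) (hc : ∃ l ∈ F, c l ≠ 0) :
    ∀ᵐ z : ι → ℝ, ∑ l ∈ F, c l * eC (zv l) z ≠ 0 := by
  obtain ⟨v, hv⟩ := exists_sep F
  have hcont : Continuous (fun z : ι → ℝ => ∑ l ∈ F, c l * eC (zv l) z) := by
    refine continuous_finsetSum _ fun l _ => continuous_const.mul (eC_cont _)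
  refine ae_mem_of_ae_add_linearMap_mem (𝕜 := ℝ) (s := {z | ∑ l ∈ F, c l * eC (zv l) z ≠ 0})
    (LinearMap.toSpanSingleton ℝ (ι → ℝ) v) volume volume ?_ ?_
  · exact (isOpen_ne.preimage hcont).measurableSet
  · intro y
    have := trig_null1 F (fun l => 2 * Real.pi * ∑ i, (l i : ℝ) * v i) (fun l => c l * eC (zv l) y) ?_ ?_
    · filter_upwards [this] with t ht
      change ∑ l ∈ F, c l * eC (zv l) (y + _) ≠ 0
      refine fun h0 => ht ?_
      rw [← h0]
      refine (Finset.sum_congr rfl fun l _ => ?_).symm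
      rw [eC_add_right, ← mul_assoc]
      congr 1
      unfold eC
      congr 3
      simp only [LinearMap.toSpanSingleton_apply, Pi.smul_apply, smul_eq_mul, zv]
      rw [mul_assoc _ _ t, Finset.sum_mul]
      congr 1
      exact Finset.sum_congr rfl fun i _ => by ring
    · intro l hl l' hl' hne h
      refine hv l hl l' hl' hne (mul_left_cancel₀ (by positivity) h)
    · obtain ⟨l, hl, h⟩ := hc
      refine ⟨l, hl, mul_ne_zero h ?_⟩
      rw [← norm_ne_zero_iff, eC_norm]; norm_num
end


section
open scoped Pointwise
set_option linter.unusedSectionVars false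
variable {ι : Type*} [Fintype ι]

def flT (μ : Measure (ι → ℝ)) (g : (ι → ℝ) → ℂ) (hg : Integrable g μ) :
    C(UnitAddTorus ι, ℂ) →L[ℂ] ℂ :=
  have hi : ∀ f : C(UnitAddTorus ι, ℂ), Integrable (fun z => f (qT z) * g z) μ := fun f =>
    hg.bdd_mul (f.continuous.comp qT_cont).aestronglyMeasurable
      (Filter.Eventually.of_forall fun z => f.norm_coe_le_norm (qT z))
  LinearMap.mkContinuous
    { toFun := fun f => ∫ z, f (qT z) * g z ∂μ
      map_add' := fun f f' => by
        rw [← integral_add (hi f) (hi f')]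
        congr 1; ext z; simp [add_mul]
      map_smul' := fun a f => by
        simp only [RingHom.id_apply, smul_eq_mul]
        rw [← integral_const_mul]
        congr 1; ext z; simp [mul_assoc] }
    (∫ z, ‖g z‖ ∂μ) (fun f => by
      refine (norm_integral_le_integral_norm _).trans ?_
      rw [mul_comm, ← integral_const_mul]
      refine integral_mono (hi f).norm (hg.norm.const_mul _) fun z => ?_
      simp only [norm_mul]
      gcongr
      exact f.norm_coe_le_norm _)

lemma flT_apply (μ : Measure (ι → ℝ)) (g : (ι → ℝ) → ℂ) (hg : Integrable g μ)
    (f : C(UnitAddTorus ι, ℂ)) : flT μ g hg f = ∫ z, f (qT z) * g z ∂μ := rfl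

def trigP (F : Finset (ι → ℤ)) (c : (ι → ℤ) → ℂ) : C(UnitAddTorus ι, ℂ) :=
  ∑ l ∈ F, c l • UnitAddTorus.mFourier l

lemma trigP_q (F : Finset (ι → ℤ)) (c : (ι → ℤ) → ℂ) (z : ι → ℝ) :
    trigP F c (qT z) = ∑ l ∈ F, c l * eC (zv l) z := by
  simp [trigP, mFourier_qT]

instance : IsFiniteMeasure (volume.restrict (cell ι)) :=
  ⟨by rw [Measure.restrict_apply_univ, cell_vol]; exact ENNReal.one_lt_top⟩

lemma zv_add (l m : ι → ℤ) : zv (l + m) = zv l + zv m := by ext; simp [zv]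
lemma zv_neg (l : ι → ℤ) : zv (-l) = - zv l := by ext; simp [zv]

lemma int_cell (f : C(UnitAddTorus ι, ℂ)) : Integrable (fun z => f (qT z)) (volume.restrict (cell ι)) :=
  Integrable.of_bound (f.continuous.comp qT_cont).aestronglyMeasurable ‖f‖
      (Filter.Eventually.of_forall fun z => f.norm_coe_le_norm (qT z))

lemma ext_cont (u : (ι → ℝ) → ℂ) (hu : Integrable u) (F : Finset (ι → ℤ)) (c : (ι → ℤ) → ℂ)
    (hF : ∀ l, l ∉ F → c l = 0) (h : ∀ l, ∫ z, eC (zv (-l)) z * u z = c l)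
    (f : C(UnitAddTorus ι, ℂ)) :
    ∫ z, f (qT z) * u z = ∫ z in cell ι, f (qT z) * trigP F c (qT z) := by
  have key : flT volume u hu = flT (volume.restrict (cell ι)) (fun z => trigP F c (qT z)) (int_cell _) := by
    refine ContinuousLinearMap.ext_on (s := Set.range (UnitAddTorus.mFourier (d := ι))) ?_ ?_
    · exact Submodule.dense_iff_topologicalClosure_eq_top.mpr UnitAddTorus.span_mFourier_closure_eq_top
    · rintro _ ⟨l, rfl⟩
      simp only [flT_apply, mFourier_qT, trigP_q]
      have h1 := h (-l)
      rw [neg_neg] at h1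
      rw [h1]
      simp_rw [Finset.mul_sum]
      have h2 : ∀ z : ι → ℝ, ∀ m, eC (zv l) z * (c m * eC (zv m) z) = c m * eC (zv (l + m)) z := by
        intro z m; rw [zv_add, eC_add_left]; ring
      simp_rw [h2]
      rw [integral_finsetSum]
      · simp_rw [integral_const_mul, orth]
        have h3 : ∀ m, l + m = 0 ↔ m = -l := fun m => by
          rw [add_comm]; exact add_eq_zero_iff_eq_neg
        simp only [h3, mul_ite, mul_one, mul_zero, Finset.sum_ite_eq']
        split_ifs with h4
        · rfl
        · exact hF _ h4
      · intro m _
        refine Integrable.const_mul ?_ _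
        simpa [mFourier_qT] using int_cell (UnitAddTorus.mFourier (l + m))
  exact DFunLike.congr_fun key f

abbrev ZL (ι : Type*) [Fintype ι] : AddSubgroup (ι → ℝ) :=
  (Submodule.span ℤ (Set.range (Pi.basisFun ℝ ι))).toAddSubgroup

lemma span_int (g : ZL ι) : ∃ l : ι → ℤ, (g : ι → ℝ) = zv l := by
  have := (Module.Basis.mem_span_iff_repr_mem ℤ (Pi.basisFun ℝ ι) (g : ι → ℝ)).mp g.2
  choose l hl using this
  refine ⟨l, ?_⟩
  ext i
  have := hl i
  simp at this
  simp [zv, this]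

lemma zv_mem (l : ι → ℤ) : zv l ∈ ZL ι := by
  change zv l ∈ Submodule.span ℤ (Set.range (Pi.basisFun ℝ ι))
  rw [Module.Basis.mem_span_iff_repr_mem]
  intro i
  exact ⟨l i, by simp [zv]⟩

instance : Countable (ZL ι) := by
  refine Function.Surjective.countable (f := fun l : ι → ℤ => (⟨zv l, zv_mem l⟩ : ZL ι)) ?_
  intro g
  obtain ⟨l, hl⟩ := span_int g
  exact ⟨l, Subtype.ext hl.symm⟩

lemma fd : IsAddFundamentalDomain (ZL ι) (cell ι) volume :=
  ZSpan.isAddFundamentalDomain' _ _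

lemma qT_eq {z u : ι → ℝ} (h : qT z = qT u) : ∃ l : ι → ℤ, z = zv l + u := by
  have : ∀ i, ∃ k : ℤ, z i = k + u i := by
    intro i
    have h1 : ((z i : ℝ) : UnitAddCircle) = (u i : ℝ) := congrFun h i
    rw [QuotientAddGroup.eq_iff_sub_mem, AddSubgroup.mem_zmultiples_iff] at h1
    obtain ⟨k, hk⟩ := h1
    refine ⟨k, ?_⟩
    simp at hk
    linarith
  choose l hl using this
  exact ⟨l, funext hl⟩

lemma cell_meas_le (U : Set (ι → ℝ)) : volume (cell ι ∩ qT ⁻¹' (qT '' U)) ≤ volume U := by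
  rw [fd.measure_eq_tsum U]
  refine le_trans (measure_mono ?_) (measure_iUnion_le _)
  rintro z ⟨hz, u, hu, huz⟩
  obtain ⟨l, hl⟩ := qT_eq huz.symm
  refine Set.mem_iUnion.mpr ⟨⟨zv l, zv_mem l⟩, ?_, hz⟩
  exact ⟨u, hu, hl.symm⟩

lemma qT_open : IsOpenMap (qT : (ι → ℝ) → UnitAddTorus ι) := by
  have : (qT : (ι → ℝ) → UnitAddTorus ι) = Pi.map (fun i => ((↑) : ℝ → UnitAddCircle)) := rfl
  rw [this]
  refine IsOpenMap.piMap (fun i => QuotientAddGroup.isOpenMap_coe) ?_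
  simp

lemma ben_core (u : (ι → ℝ) → ℂ) (hu : Integrable u) (U : Set (ι → ℝ)) (hU : IsOpen U)
    (hsU : Function.support u ⊆ U) (hU1 : volume U < 1) (c : (ι → ℤ) → ℂ)
    (hF : {l | c l ≠ 0}.Finite) (h : ∀ l, ∫ z, eC (zv (-l)) z * u z = c l) : ∀ l, c l = 0 := by
  classical
  by_contra! hne
  obtain ⟨l0, hl0⟩ := hne
  set F := hF.toFinset
  have hF' : ∀ l, l ∉ F → c l = 0 := by
    intro l hl; by_contra h; exact hl (hF.mem_toFinset.mpr h)
  have hnull := trig_null F c ⟨l0, hF.mem_toFinset.mpr hl0, hl0⟩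
  set C : Set (UnitAddTorus ι) := (qT '' U)ᶜ
  have hC : IsClosed C := (qT_open U hU).isClosed_compl
  let P := trigP F c
  let f : ℕ → C(UnitAddTorus ι, ℂ) := fun n =>
    ⟨fun x => ((hC.apprSeq n x : NNReal) : ℝ) * (starRingEnd ℂ) (P x), by
      have := (hC.apprSeq n).continuous
      fun_prop⟩
  have hfa : ∀ n x, f n x = (((hC.apprSeq n x : NNReal) : ℝ) : ℂ) * (starRingEnd ℂ) (P x) := fun n x => rfl
  have hlim : ∀ x, Filter.Tendsto (fun n => f n x) Filter.atTop
      (nhds (C.indicator (fun x => (starRingEnd ℂ) (P x)) x)) := by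
    intro x
    have h1 := (tendsto_pi_nhds.mp (HasOuterApproxClosed.tendsto_apprSeq hC)) x
    have h2 : Filter.Tendsto (fun n => (((hC.apprSeq n x : NNReal) : ℝ) : ℂ)) Filter.atTop
      (nhds (((C.indicator (fun _ => (1:NNReal)) x : NNReal) : ℝ) : ℂ)) :=
      (Complex.continuous_ofReal.tendsto _).comp ((NNReal.continuous_coe.tendsto _).comp h1)
    have h3 : C.indicator (fun x => (starRingEnd ℂ) (P x)) x =
      (((C.indicator (fun _ => (1:NNReal)) x : NNReal) : ℝ) : ℂ) * (starRingEnd ℂ) (P x) := by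
      by_cases hx : x ∈ C
      · simp [Set.indicator_of_mem hx]
      · simp [Set.indicator_of_notMem hx]
    rw [h3]
    exact h2.mul_const ((starRingEnd ℂ) (P x))
  have hbd : ∀ n x, ‖f n x‖ ≤ ‖P‖ := by
    intro n x
    rw [hfa, norm_mul, RCLike.norm_conj]
    have h1 : ‖(((hC.apprSeq n x : NNReal) : ℝ) : ℂ)‖ ≤ 1 := by
      simp only [Complex.norm_real, NNReal.norm_eq]
      exact_mod_cast HasOuterApproxClosed.apprSeq_apply_le_one hC n x
    calc _ ≤ 1 * ‖P‖ := mul_le_mul h1 (P.norm_coe_le_norm x) (norm_nonneg _) zero_le_one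
      _ = _ := one_mul _
  have L1 : Filter.Tendsto (fun n => ∫ z, f n (qT z) * u z) Filter.atTop
      (nhds (∫ z, C.indicator (fun x => (starRingEnd ℂ) (P x)) (qT z) * u z)) := by
    refine tendsto_integral_of_dominated_convergence (fun z => ‖P‖ * ‖u z‖) ?_ (hu.norm.const_mul _) ?_ ?_
    · intro n
      exact ((f n).continuous.comp qT_cont).aestronglyMeasurable.mul hu.1
    · intro n
      refine Filter.Eventually.of_forall fun z => ?_
      rw [norm_mul]; gcongr; exact hbd _ _
    · exact Filter.Eventually.of_forall fun z => (hlim _).mul_const _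
  have L2 : Filter.Tendsto (fun n => ∫ z in cell ι, f n (qT z) * P (qT z)) Filter.atTop
      (nhds (∫ z in cell ι, C.indicator (fun x => (starRingEnd ℂ) (P x)) (qT z) * P (qT z))) := by
    refine tendsto_integral_of_dominated_convergence (fun z => ‖P‖ * ‖P‖) ?_ (integrable_const _) ?_ ?_
    · intro n
      exact (((f n).continuous.comp qT_cont).mul (P.continuous.comp qT_cont)).aestronglyMeasurable
    · intro n
      refine Filter.Eventually.of_forall fun z => ?_
      rw [norm_mul]; gcongr
      · exact hbd _ _
      · exact P.norm_coe_le_norm _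
    · exact Filter.Eventually.of_forall fun z => (hlim _).mul_const _
  have hz : ∀ z, C.indicator (fun x => (starRingEnd ℂ) (P x)) (qT z) * u z = 0 := by
    intro z
    by_cases hx : u z = 0
    · simp [hx]
    · have : qT z ∉ C := fun hcc => hcc ⟨z, hsU hx, rfl⟩
      simp [this]
  simp_rw [hz, integral_zero] at L1
  have heq : ∀ n, ∫ z, f n (qT z) * u z = ∫ z in cell ι, f n (qT z) * P (qT z) :=
    fun n => ext_cont u hu F c hF' h (f n)
  simp_rw [heq] at L1
  have h0 := tendsto_nhds_unique L1 L2
  have hsq : ∀ z, C.indicator (fun x => (starRingEnd ℂ) (P x)) (qT z) * P (qT z)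
      = ((C.indicator (fun x => ‖P x‖ ^ 2) (qT z) : ℝ) : ℂ) := by
    intro z
    by_cases hx : qT z ∈ C
    · simp [hx, Complex.conj_mul']
    · simp [hx]
  simp_rw [hsq] at h0
  rw [integral_complex_ofReal] at h0
  have h1 : ∫ z in cell ι, C.indicator (fun x => ‖P x‖ ^ 2) (qT z) = 0 := by exact_mod_cast h0.symm
  rw [integral_eq_zero_iff_of_nonneg] at h1
  · have h2 : ∀ᵐ z ∂(volume.restrict (cell ι)), qT z ∉ C := by
      filter_upwards [h1, ae_restrict_of_ae hnull] with z hz1 hz2 hzC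
      simp only [Set.indicator_of_mem hzC, Pi.zero_apply] at hz1
      rw [← trigP_q] at hz2
      exact hz2 (by simpa using hz1)
    have h3 : volume (cell ι ∩ qT ⁻¹' C) = 0 := by
      rw [ae_iff] at h2
      rw [Measure.restrict_apply' cell_meas] at h2
      rw [Set.inter_comm]
      simp only [not_not] at h2
      exact h2
    have h4 : volume (cell ι) ≤ volume (cell ι ∩ qT ⁻¹' C) + volume (cell ι ∩ qT ⁻¹' (qT '' U)) := by
      refine le_trans (measure_mono ?_) (measure_union_le _ _)
      intro z hz
      by_cases hx : qT z ∈ C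
      · exact Or.inl ⟨hz, hx⟩
      · exact Or.inr ⟨hz, not_not.mp hx⟩
    rw [h3, zero_add, cell_vol] at h4
    exact absurd (h4.trans (cell_meas_le U)) (not_le.mpr hU1)
  · intro z
    exact Set.indicator_nonneg (fun _ _ => by positivity) _
  · refine Integrable.of_bound ?_ (‖P‖ ^ 2) ?_
    · refine ((Measurable.indicator (f := fun z => ‖P (qT z)‖^2) ?_ (hC.preimage qT_cont).measurableSet).aestronglyMeasurable)
      exact ((P.continuous.comp qT_cont).norm.pow 2).measurable
    · refine Filter.Eventually.of_forall fun z => ?_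
      by_cases hx : qT z ∈ C
      · simp only [Set.indicator_of_mem hx, norm_pow, norm_norm]
        gcongr; exact P.norm_coe_le_norm _
      · simp only [Set.indicator_of_notMem hx, norm_zero]; positivity

theorem benedicks (h : (ι → ℝ) → ℂ) (hint : Integrable h) (hs : volume (Function.support h) < 1)
    (hhat : volume {w : ι → ℝ | ∫ z, eC (-w) z * h z ≠ 0} < ⊤) :
    ∀ᵐ w : ι → ℝ, ∫ z, eC (-w) z * h z = 0 := by
  obtain ⟨U, hsU, hU, hU1⟩ := (Function.support h).exists_isOpen_lt_of_lt 1 hs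
  set S := {w : ι → ℝ | ∫ z, eC (-w) z * h z ≠ 0} with hS
  have h1 := fd.measure_eq_tsum S
  have h2 : ∀ᵐ w ∂(volume.restrict (cell ι)),
      {g : ZL ι | w ∈ g +ᵥ S}.Finite := by
    apply ae_finite_setOfPred_mem
    simp_rw [Measure.restrict_apply' cell_meas]
    rw [← h1]; exact hhat.ne
  set Bad := {w : ι → ℝ | ∃ l : ι → ℤ, w + zv l ∈ S} with hBad
  have h3 : ∀ᵐ w ∂(volume.restrict (cell ι)), w ∉ Bad := by
    filter_upwards [h2] with w hw
    have key := ben_core (fun z => eC (-w) z * h z) ?_ U hU ?_ hU1 (fun l => ∫ z, eC (-(w + zv l)) z * h z) ?_ ?_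
    · rintro ⟨l, hl⟩; exact hl (key l)
    · refine hint.bdd_mul (c := 1) (eC_cont _).aestronglyMeasurable ?_
      exact Filter.Eventually.of_forall fun z => (eC_norm _ _).le
    · intro z hz
      apply hsU
      intro h0; apply hz; simp [h0]
    · refine Set.Finite.of_finite_image (f := fun l => (⟨zv (-l), zv_mem _⟩ : ZL ι)) (hw.subset ?_) ?_
      · rintro _ ⟨l, hl, rfl⟩
        refine ⟨w + zv l, hl, ?_⟩
        change zv (-l) + (w + zv l) = w
        rw [zv_neg]; abel
      · intro l _ l' _ hll
        have := congrArg Subtype.val hll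
        ext i
        have := congrFun this i
        simpa [zv] using this
    · intro l
      congr 1; ext z
      rw [neg_add, eC_add_left, zv_neg]; ring
  have h4 : volume Bad = 0 := by
    refine fd.measure_zero_of_invariant Bad ?_ ?_
    · intro g
      obtain ⟨m, hm⟩ := span_int g
      ext w
      constructor
      · rintro ⟨v, ⟨l, hl⟩, rfl⟩
        refine ⟨l - m, ?_⟩
        change (g : ι → ℝ) + v + zv (l - m) ∈ S
        convert hl using 1
        rw [hm, sub_eq_add_neg, zv_add, zv_neg]; abel
      · rintro ⟨l, hl⟩
        refine ⟨-(g : ι → ℝ) + w, ⟨l + m, ?_⟩, ?_⟩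
        · convert hl using 1
          rw [hm, zv_add]; abel
        · change (g : ι → ℝ) + (-(g : ι → ℝ) + w) = w
          abel
    · rw [ae_iff] at h3
      rw [Measure.restrict_apply' cell_meas] at h3
      simpa using h3
  refine measure_mono_null ?_ h4
  intro w hw
  refine ⟨0, ?_⟩
  have : zv (0 : ι → ℤ) = 0 := by ext; simp [zv]
  rw [this, add_zero]; exact hw
end


section
set_option linter.unusedSectionVars false
variable {ι : Type*} [Fintype ι]

theorem benedicks' [Nonempty ι] (h : (ι → ℝ) → ℂ) (hint : Integrable h)
    (hs : volume (Function.support h) < ⊤)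
    (hhat : volume {w : ι → ℝ | ∫ z, eC (-w) z * h z ≠ 0} < ⊤) :
    ∀ᵐ w : ι → ℝ, ∫ z, eC (-w) z * h z = 0 := by
  set R : ℝ := (volume (Function.support h)).toReal + 1 with hR
  have hR1 : 1 ≤ R := by
    have : 0 ≤ (volume (Function.support h)).toReal := ENNReal.toReal_nonneg
    linarith
  have hR0 : R ≠ 0 := by linarith
  have hint' : Integrable (fun z => h (R • z)) := hint.comp_smul hR0
  have hft : ∀ w : ι → ℝ, ∫ z, eC (-w) z * h (R • z)
      = |(R ^ Module.finrank ℝ (ι → ℝ))⁻¹| • ∫ z, eC (-(R⁻¹ • w)) z * h z := by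
    intro w
    rw [← Measure.integral_comp_smul]
    congr 1; ext z; congr 1
    unfold eC; congr 4
    refine Finset.sum_congr rfl fun i _ => ?_
    simp only [Pi.neg_apply, Pi.smul_apply, smul_eq_mul]
    field_simp
  have hne : |(R ^ Module.finrank ℝ (ι → ℝ))⁻¹| ≠ 0 := by
    rw [abs_ne_zero]; exact inv_ne_zero (pow_ne_zero _ hR0)
  have hset : {w : ι → ℝ | ∫ z, eC (-w) z * h (R • z) ≠ 0} =
      (fun w => R⁻¹ • w) ⁻¹' {w : ι → ℝ | ∫ z, eC (-w) z * h z ≠ 0} := by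
    ext w
    change (_ ≠ _) ↔ (_ ≠ _)
    rw [hft w, smul_ne_zero_iff]
    exact ⟨fun h => h.2, fun h => ⟨hne, h⟩⟩
  have key := benedicks (fun z => h (R • z)) hint' ?_ ?_
  · rw [ae_iff] at key ⊢
    have h2 : {w : ι → ℝ | ¬ ∫ z, eC (-w) z * h (R • z) = 0} = _ := hset
    rw [h2, Measure.addHaar_preimage_smul _ (inv_ne_zero hR0)] at key
    rcases mul_eq_zero.mp key with h3 | h3
    · exfalso
      rw [ENNReal.ofReal_eq_zero] at h3
      have : 0 < |((R⁻¹) ^ Module.finrank ℝ (ι → ℝ))⁻¹| := by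
        rw [abs_pos]; exact inv_ne_zero (pow_ne_zero _ (inv_ne_zero hR0))
      linarith
    · exact h3
  · have : Function.support (fun z => h (R • z)) = (fun z => R • z) ⁻¹' (Function.support h) := rfl
    rw [this, Measure.addHaar_preimage_smul _ hR0]
    rw [← ENNReal.ofReal_toReal hs.ne, ← ENNReal.ofReal_mul (abs_nonneg _)]
    rw [← ENNReal.ofReal_one, ENNReal.ofReal_lt_ofReal_iff one_pos]
    rw [abs_of_nonneg (by positivity), inv_mul_lt_one₀ (by positivity)]
    have h4 : R ^ 1 ≤ R ^ Module.finrank ℝ (ι → ℝ) :=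
      pow_le_pow_right₀ hR1 (Module.finrank_pos)
    rw [pow_one] at h4
    linarith
  · rw [hset, Measure.addHaar_preimage_smul _ (inv_ne_zero hR0)]
    exact ENNReal.mul_lt_top ENNReal.ofReal_lt_top hhat
end

section
variable {n : ℕ}

def eV (x ξ : En n) : ℂ := eC x.ofLp ξ.ofLp

lemma eV_add_left (a b z : En n) : eV (a + b) z = eV a z * eV b z := eC_add_left _ _ _
lemma eV_add_right (a z y : En n) : eV a (z + y) = eV a z * eV a y := eC_add_right _ _ _
lemma eV_norm (a z : En n) : ‖eV a z‖ = 1 := eC_norm _ _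
lemma eV_cont2 : Continuous (fun p : En n × En n => eV p.1 p.2) := by
  unfold eV
  exact eC_cont2.comp (f := fun p : En n × En n => (p.1.ofLp, p.2.ofLp)) (by fun_prop)
lemma eV_cont (a : En n) : Continuous (eV a) := eV_cont2.comp (Continuous.prodMk_right a)
lemma eV_cont_left (a : En n) : Continuous (fun x => eV x a) := eV_cont2.comp (Continuous.prodMk_left a)

def eqE (n : ℕ) : (Fin n ⊕ Fin n → ℝ) ≃ᵐ En n × En n :=
  (MeasurableEquiv.sumPiEquivProdPi (fun _ : Fin n ⊕ Fin n => ℝ)).trans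
    ((MeasurableEquiv.toLp 2 (Fin n → ℝ)).prodCongr (MeasurableEquiv.toLp 2 (Fin n → ℝ)))

lemma eqE_mp : MeasurePreserving (eqE n) volume volume := by
  refine MeasurePreserving.trans (μb := volume)
    (volume_measurePreserving_sumPiEquivProdPi (fun _ : Fin n ⊕ Fin n => ℝ)) ?_
  exact (PiLp.volume_preserving_toLp (Fin n)).prod (PiLp.volume_preserving_toLp (Fin n))

lemma eqE_eC (w z : Fin n ⊕ Fin n → ℝ) :
    eC (-w) z = eV (-(eqE n w).1) (eqE n z).1 * eV (-(eqE n w).2) (eqE n z).2 := by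
  unfold eV eC
  rw [← Complex.exp_add, ← add_mul, ← Complex.ofReal_add, ← mul_add, Fintype.sum_sum_type]
  rfl

theorem benV (hn : 1 ≤ n) (H : En n × En n → ℂ) (hint : Integrable H)
    (hs : volume (Function.support H) < ⊤)
    (hhat : volume {w : En n × En n | ∫ z : En n × En n, eV (-w.1) z.1 * eV (-w.2) z.2 * H z ≠ 0} < ⊤) :
    ∀ᵐ w : En n × En n, ∫ z : En n × En n, eV (-w.1) z.1 * eV (-w.2) z.2 * H z = 0 := by
  have hft : ∀ w, ∫ z, eC (-w) z * H (eqE n z) = ∫ z : En n × En n, eV (-(eqE n w).1) z.1 * eV (-(eqE n w).2) z.2 * H z := by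
    intro w
    rw [← eqE_mp.integral_comp']
    simp_rw [eqE_eC]
  have : Nonempty (Fin n ⊕ Fin n) := ⟨Sum.inl ⟨0, hn⟩⟩
  have key := benedicks' (fun z => H (eqE n z)) ?_ ?_ ?_
  · simp_rw [hft] at key
    rw [ae_iff] at key ⊢
    rw [← eqE_mp.measure_preimage_equiv]
    exact key
  · exact (eqE_mp.integrable_comp_emb (eqE n).measurableEmbedding).mpr hint
  · have := eqE_mp.measure_preimage_equiv (Function.support H)
    rw [← this] at hs
    exact hs
  · simp_rw [hft]
    rw [← eqE_mp.measure_preimage_equiv] at hhat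
    exact hhat

open FourierTransform in
lemma inv_ae (f : En n → ℂ) (hf : Integrable f)
    (hF : Integrable (fun x => ∫ ξ, eV (-x) ξ * f ξ)) :
    ∀ᵐ ξ, ∫ x, eV x ξ * (∫ ξ, eV (-x) ξ * f ξ) = f ξ := by
  have hdot : ∀ a b : En n, inner ℝ a b = ∑ i, b i * a i := by
    intro a b; simp [PiLp.inner_apply]
  have e1 : (fun x => ∫ ξ, eV (-x) ξ * f ξ) = 𝓕 f := by
    ext x
    rw [Real.fourier_eq']
    congr 1; ext ξ
    rw [smul_eq_mul, hdot]
    unfold eV eC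
    congr 4
    simp [Finset.sum_neg_distrib]
  have e2 : ∀ u : En n → ℂ, (fun ξ => ∫ x, eV x ξ * u x) = 𝓕⁻ u := by
    intro u
    ext x
    rw [Real.fourierInv_eq']
    congr 1; ext ξ
    rw [smul_eq_mul, hdot]
    unfold eV eC
    congr 4
    congr 1
    refine Finset.sum_congr rfl fun i _ => ?_
    ring
  rw [e1] at hF
  have e3 : ∀ ξ, ∫ x, eV x ξ * (∫ ξ, eV (-x) ξ * f ξ) = 𝓕⁻ (𝓕 f) ξ := by
    intro ξ
    rw [← e1, ← e2]
  simp_rw [e3]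
  have hL : Continuous fun p : En n × En n ↦ innerₗ (En n) p.1 p.2 := continuous_inner
  have hL' : Continuous fun p : En n × En n ↦ (-innerₗ (En n)) p.1 p.2 := continuous_inner.neg
  have hci : Continuous (𝓕⁻ (𝓕 f)) :=
    VectorFourier.fourierIntegral_continuous Real.continuous_fourierChar hL' hF
  refine ae_eq_of_integral_contDiff_smul_eq hci.locallyIntegrable hf.locallyIntegrable ?_
  intro g hg hgc
  let Θ : SchwartzMap (En n) ℂ := (HasCompactSupport.comp_left (g := (fun r : ℝ => (r : ℂ))) hgc
    Complex.ofReal_zero).toSchwartzMap (Complex.ofRealCLM.contDiff.comp hg)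
  have hΘ : ∀ x, Θ x = (g x : ℂ) := fun x => rfl
  have h1 := VectorFourier.integral_fourierIntegral_smul_eq_flip (L := -innerₗ (En n)) (μ := volume) (ν := volume)
    Real.continuous_fourierChar hL' hF Θ.integrable
  have h2 := VectorFourier.integral_fourierIntegral_smul_eq_flip (L := innerₗ (En n)) (μ := volume) (ν := volume)
    Real.continuous_fourierChar hL hf (𝓕⁻ Θ).integrable
  have hflip : (innerₗ (En n)).flip = innerₗ (En n) := by
    ext x y; simp [real_inner_comm]
  have hflip' : (-innerₗ (En n)).flip = -innerₗ (En n) := by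
    ext x y; simp [real_inner_comm]
  rw [hflip] at h2
  rw [hflip'] at h1
  have h3 : VectorFourier.fourierIntegral Real.fourierChar volume (-innerₗ (En n)) Θ = ⇑(𝓕⁻ Θ : SchwartzMap (En n) ℂ) := by
    rw [SchwartzMap.fourierInv_coe]; rfl
  have h4 : VectorFourier.fourierIntegral Real.fourierChar volume (innerₗ (En n)) (⇑(𝓕⁻ Θ : SchwartzMap (En n) ℂ)) = ⇑Θ := by
    have : 𝓕 (𝓕⁻ Θ : SchwartzMap (En n) ℂ) = Θ := FourierTransform.fourier_fourierInv_eq Θ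
    conv_rhs => rw [← this]
    rw [SchwartzMap.fourier_coe]; rfl
  rw [h3] at h1
  rw [h4] at h2
  have h5 := h1.trans h2
  have h6 : ∀ u : En n → ℂ, ∫ x, g x • u x = ∫ x, u x • Θ x := by
    intro u; congr 1; ext x
    rw [hΘ, smul_eq_mul, mul_comm, Complex.real_smul]
  rw [h6, h6]
  exact h5
end

section
variable {W : Type*} [NormedAddCommGroup W] [NormedSpace ℝ W] [FiniteDimensional ℝ W]
  [MeasureSpace W] [BorelSpace W] [(volume : Measure W).IsAddHaarMeasure]

def Lq (W : Type*) [AddCommGroup W] [Module ℝ W] : (W × W) ≃ₗ[ℝ] (W × W) where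
  toFun p := (p.2 + p.1, p.2 - p.1)
  invFun q := ((1 / 2 : ℝ) • (q.1 - q.2), (1 / 2 : ℝ) • (q.1 + q.2))
  left_inv p := by ext <;> simp <;> module
  right_inv p := by ext <;> simp <;> module
  map_add' p q := by ext <;> simp <;> abel
  map_smul' c p := by ext <;> simp [smul_sub]

lemma Lq_emb : MeasurableEmbedding (Lq W) := by
  have := FiniteDimensional.proper_real W
  exact (Lq W).toContinuousLinearEquiv.toHomeomorph.measurableEmbedding

lemma Lq_map : ∃ c : ENNReal, c ≠ 0 ∧ c ≠ ⊤ ∧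
    Measure.map (Lq W) (volume : Measure (W × W)) = c • volume := by
  have := FiniteDimensional.proper_real W
  have hdet : LinearMap.det (Lq W : (W × W) →ₗ[ℝ] (W × W)) ≠ 0 := (Lq W).isUnit_det'.ne_zero
  have : (volume : Measure (W × W)).IsAddHaarMeasure :=
    inferInstanceAs (((volume : Measure W).prod (volume : Measure W)).IsAddHaarMeasure)
  refine ⟨ENNReal.ofReal |(LinearMap.det (Lq W : (W × W) →ₗ[ℝ] (W × W)))⁻¹|, ?_, ENNReal.ofReal_ne_top,
    Measure.map_linearMap_addHaar_eq_smul_addHaar _ hdet⟩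
  simp only [ne_eq, ENNReal.ofReal_eq_zero, not_le]
  positivity

lemma Lae (P : W × W → Prop) (h : ∀ᵐ p : W × W, P (p.2 + p.1, p.2 - p.1)) : ∀ᵐ q, P q := by
  obtain ⟨c, hc, hc', hm⟩ := Lq_map (W := W)
  have h1 : ∀ᵐ q ∂(Measure.map (Lq W) (volume : Measure (W × W))), P q :=
    Lq_emb.ae_map_iff.mpr h
  rw [hm] at h1
  exact (Measure.ae_ennreal_smul_measure_iff hc).mp h1

lemma Lint : ∃ C : ℝ, ∀ M : W × W → ℂ, ∫ q, M q = C * ∫ p : W × W, M (p.2 + p.1, p.2 - p.1) := by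
  obtain ⟨c, hc, hc', hm⟩ := Lq_map (W := W)
  refine ⟨c.toReal⁻¹, fun M => ?_⟩
  have h1 : ∫ p : W × W, M (p.2 + p.1, p.2 - p.1) = ∫ q, M q ∂(Measure.map (Lq W) volume) :=
    (Lq_emb.integral_map M).symm
  rw [h1, hm, integral_smul_measure, Complex.real_smul, ← mul_assoc, ← Complex.ofReal_mul,
    inv_mul_cancel₀ (ENNReal.toReal_ne_zero.mpr ⟨hc, hc'⟩)]
  simp

lemma Lintegrable (M : W × W → ℂ) (h : Integrable M) :
    Integrable (fun p : W × W => M (p.2 + p.1, p.2 - p.1)) := by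
  obtain ⟨c, hc, hc', hm⟩ := Lq_map (W := W)
  refine (Lq_emb.integrable_map_iff (g := M)).mp ?_
  rw [hm]
  exact h.smul_measure hc'
end

section
variable {n : ℕ}

def BB (f g : En n → ℂ) (z : En n × En n) : ℂ :=
  ∫ ξ, eV (-((1 / 2 : ℝ) • z.1)) ξ * (f (ξ + z.2) * g (ξ - z.2))

lemma eV_mul_int (a : En n) {u : En n → ℂ} (hu : Integrable u) :
    Integrable (fun ξ => eV a ξ * u ξ) := by
  refine hu.bdd_mul (c := 1) (eV_cont a).aestronglyMeasurable ?_
  filter_upwards with x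
  rw [eV_norm]

lemma G_int {f g : En n → ℂ} (hf : MemLp f 2) (hg : MemLp g 2) (y : En n) :
    Integrable (fun ξ => f (ξ + y) * g (ξ - y)) := by
  have h1 := hf.comp_measurePreserving (measurePreserving_add_right volume y)
  have h2 := hg.comp_measurePreserving (measurePreserving_sub_right volume y)
  exact h1.integrable_mul h2

lemma BB_bound {f g : En n → ℂ} (hf : MemLp f 2) (hg : MemLp g 2) (z : En n × En n) :
    ‖BB f g z‖ ≤ ((∫ ξ, ‖f ξ‖ ^ 2) + ∫ ξ, ‖g ξ‖ ^ 2) := by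
  have h1 : Integrable (fun ξ => ‖f ξ‖ ^ 2) := hf.integrable_norm_pow (by norm_num)
  have h2 : Integrable (fun ξ => ‖g ξ‖ ^ 2) := hg.integrable_norm_pow (by norm_num)
  have h1' : Integrable (fun ξ => ‖f (ξ + z.2)‖ ^ 2) := h1.comp_add_right z.2
  have h2' : Integrable (fun ξ => ‖g (ξ - z.2)‖ ^ 2) := h2.comp_sub_right z.2
  rw [← integral_add_right_eq_self (fun ξ => ‖f ξ‖ ^ 2) z.2,
    ← integral_sub_right_eq_self (fun ξ => ‖g ξ‖ ^ 2) z.2, ← integral_add h1' h2']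
  refine norm_integral_le_of_norm_le (h1'.add h2') ?_
  filter_upwards with ξ
  rw [norm_mul, eV_norm, one_mul, norm_mul]
  nlinarith [sq_nonneg (‖f (ξ + z.2)‖ - ‖g (ξ - z.2)‖), sq_nonneg (‖f (ξ + z.2)‖), sq_nonneg (‖g (ξ - z.2)‖)]

lemma BB_meas {f g : En n → ℂ} (hf : StronglyMeasurable f) (hg : StronglyMeasurable g) :
    StronglyMeasurable (BB f g) := by
  refine StronglyMeasurable.integral_prod_right'
    (f := fun p : (En n × En n) × En n =>
      eV (-((1 / 2 : ℝ) • p.1.1)) p.2 * (f (p.2 + p.1.2) * g (p.2 - p.1.2))) ?_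
  refine StronglyMeasurable.mul ?_ (StronglyMeasurable.mul ?_ ?_)
  · exact (eV_cont2.comp (f := fun p : (En n × En n) × En n => (-((1 / 2 : ℝ) • p.1.1), p.2))
      (by fun_prop)).stronglyMeasurable
  · exact hf.comp_measurable (by fun_prop)
  · exact hg.comp_measurable (by fun_prop)

def KK (f g : En n → ℂ) (s y : En n) : ℂ :=
  ∫ m, (f (m + s + y) * g (m + s - y)) * (f (m - s - y) * g (m - s + y))

lemma KK_symm (f g : En n → ℂ) (s y : En n) : KK f g s y = KK f g y s := by
  unfold KK
  congr 1; ext m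
  rw [show m + y + s = m + s + y by abel, show m + y - s = m - s + y by abel,
    show m - y - s = m - s - y by abel, show m - y + s = m + s - y by abel]
  ring

lemma KK_meas {f g : En n → ℂ} (hf : StronglyMeasurable f) (hg : StronglyMeasurable g) :
    StronglyMeasurable (fun p : En n × En n => KK f g p.1 p.2) := by
  refine StronglyMeasurable.integral_prod_right'
    (f := fun p : (En n × En n) × En n => (f (p.2 + p.1.1 + p.1.2) * g (p.2 + p.1.1 - p.1.2))
      * (f (p.2 - p.1.1 - p.1.2) * g (p.2 - p.1.1 + p.1.2))) ?_
  refine StronglyMeasurable.mul (StronglyMeasurable.mul ?_ ?_) (StronglyMeasurable.mul ?_ ?_)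
  · exact hf.comp_measurable (by fun_prop)
  · exact hg.comp_measurable (by fun_prop)
  · exact hf.comp_measurable (by fun_prop)
  · exact hg.comp_measurable (by fun_prop)

lemma eV_half (x s m : En n) :
    eV (-((1 / 2 : ℝ) • x)) (m + s) * eV (-((1 / 2 : ℝ) • (-x))) (m - s) = eV (-x) s := by
  unfold eV eC
  rw [← Complex.exp_add, ← add_mul, ← Complex.ofReal_add, ← mul_add, ← Finset.sum_add_distrib]
  congr 4
  refine Finset.sum_congr rfl fun i _ => ?_
  simp
  ring

lemma HK : ∃ C : ℝ, ∀ f g : En n → ℂ, MemLp f 2 → MemLp g 2 → ∀ y : En n,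
    Integrable (fun s => KK f g s y) ∧
    ∀ x, BB f g (x, y) * BB f g (-x, -y) = C * ∫ s, eV (-x) s * KK f g s y := by
  obtain ⟨C, hC⟩ := Lint (W := En n)
  refine ⟨C, fun f g hf hg y => ⟨?_, fun x => ?_⟩⟩
  · have h1 := (G_int hf hg y).mul_prod (G_int hf hg (-y))
    have h2 := (Lintegrable _ h1).integral_prod_left
    refine h2.congr (ae_of_all _ fun s => ?_)
    unfold KK
    refine integral_congr_ae (ae_of_all _ fun m => ?_)
    simp [sub_eq_add_neg]
  · have h1 := (eV_mul_int (-((1 / 2 : ℝ) • x)) (G_int hf hg y)).mul_prod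
      (eV_mul_int (-((1 / 2 : ℝ) • (-x))) (G_int hf hg (-y)))
    have h2 := (Lintegrable _ h1)
    unfold BB
    rw [← integral_prod_mul, ← Measure.volume_eq_prod, hC, Measure.volume_eq_prod, integral_prod _ h2]
    congr 2; ext s
    unfold KK
    rw [← integral_const_mul]
    congr 1; ext m
    rw [← eV_half x s m]
    simp only [sub_neg_eq_add, ← sub_eq_add_neg]
    ring
end

section
variable {n : ℕ}

lemma eV_comm (a b : En n) : eV a b = eV b a := by
  unfold eV eC
  congr 4
  refine Finset.sum_congr rfl fun i _ => ?_
  ring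

lemma Hzero (hn : 1 ≤ n) {f g : En n → ℂ} (hf : StronglyMeasurable f) (hg : StronglyMeasurable g)
    (hf2 : MemLp f 2) (hg2 : MemLp g 2) (hfin : volume {z | BB f g z ≠ 0} < ⊤) :
    ∀ᵐ z, BB f g z * BB f g (-z) = 0 := by
  obtain ⟨C, hC⟩ := HK (n := n)
  have hC := hC f g hf2 hg2
  set H : En n × En n → ℂ := fun z => BB f g z * BB f g (-z) with hH
  have hBm := BB_meas hf hg
  have hHm : StronglyMeasurable H := hBm.mul (hBm.comp_measurable measurable_neg)
  have hsub : Function.support H ⊆ {z | BB f g z ≠ 0} := by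
    intro z hz hz'
    apply hz
    change BB f g z * _ = 0
    rw [show BB f g z = 0 from hz', zero_mul]
  have hs : volume (Function.support H) < ⊤ := (measure_mono hsub).trans_lt hfin
  have hHi : Integrable H := by
    rw [← integrableOn_iff_integrable_of_support_subset (le_refl (Function.support H))]
    have : IsFiniteMeasure (volume.restrict (Function.support H)) := ⟨by simpa using hs⟩
    set D := ((∫ ξ, ‖f ξ‖ ^ 2) + ∫ ξ, ‖g ξ‖ ^ 2) with hD
    refine Integrable.of_bound (C := D * D) hHm.aestronglyMeasurable ?_
    filter_upwards with z
    rw [hH]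
    simp only [norm_mul]
    have h1 := BB_bound hf2 hg2 z
    have h2 := BB_bound hf2 hg2 (-z)
    gcongr
  have hHe : ∀ x y, H (x, y) = ∫ s, eV (-x) s * (C * KK f g s y) := by
    intro x y
    change BB f g (x, y) * BB f g (-x, -y) = _
    rw [(hC y).2 x, ← integral_const_mul]
    congr 1; ext s; ring
  have hKi : ∀ y, Integrable (fun s => C * KK f g s y) := fun y => (hC y).1.const_mul _
  have hKm := KK_meas hf hg
  have step1 : ∀ᵐ y, ∀ᵐ s, ∫ x, eV x s * H (x, y) = C * KK f g s y := by
    have h1 : ∀ᵐ y, Integrable (fun x => H (x, y)) := Integrable.prod_left_ae hHi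
    filter_upwards [h1] with y hy
    have h2 := inv_ae _ (hKi y) (hy.congr (ae_of_all _ fun x => hHe x y))
    filter_upwards [h2] with s h3
    rw [← h3]
    congr 1; ext x
    rw [hHe]
  have step2 : ∀ᵐ s, ∀ᵐ y, ∫ x, eV x s * H (x, y) = C * KK f g s y := by
    refine (Measure.ae_ae_comm ?_).mp step1
    have hl : StronglyMeasurable (fun p : En n × En n => ∫ x, eV x p.2 * H (x, p.1)) := by
      refine StronglyMeasurable.integral_prod_right'
        (f := fun p : (En n × En n) × En n => eV p.2 p.1.2 * H (p.2, p.1.1)) ?_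
      refine StronglyMeasurable.mul ?_ (hHm.comp_measurable (by fun_prop))
      exact (eV_cont2.comp (f := fun p : (En n × En n) × En n => (p.2, p.1.2))
        (by fun_prop)).stronglyMeasurable
    have hr : StronglyMeasurable (fun p : En n × En n => C * KK f g p.2 p.1) :=
      (hKm.comp_measurable (g := fun p : En n × En n => (p.2, p.1)) (by fun_prop)).const_mul _
    exact measurableSet_eq_fun hl.measurable hr.measurable
  have step3 : ∀ᵐ s, ∀ b, ∫ z : En n × En n, eV s z.1 * eV (-b) z.2 * H z = H (b, s) := by
    filter_upwards [step2] with s hs b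
    have hi : Integrable (fun z : En n × En n => eV s z.1 * eV (-b) z.2 * H z) := by
      refine hHi.bdd_mul (c := 1) ?_ ?_
      · exact Continuous.aestronglyMeasurable (((eV_cont s).comp continuous_fst).mul
          ((eV_cont (-b)).comp continuous_snd))
      · filter_upwards with z
        rw [norm_mul, eV_norm, eV_norm, one_mul]
    rw [Measure.volume_eq_prod, integral_prod_symm _ hi, hHe]
    refine integral_congr_ae ?_
    filter_upwards [hs] with y hy
    rw [KK_symm, ← hy, ← integral_const_mul]
    refine integral_congr_ae (ae_of_all _ fun x => ?_)
    change eV s x * eV (-b) y * H (x, y) = eV (-b) y * (eV x s * H (x, y))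
    rw [eV_comm x s]; ring
  have step4 : ∀ᵐ w : En n × En n,
      ∫ z : En n × En n, eV (-w.1) z.1 * eV (-w.2) z.2 * H z = H (w.2, -w.1) := by
    have h1 : ∀ᵐ a : En n, ∀ b, ∫ z : En n × En n, eV (-a) z.1 * eV (-b) z.2 * H z = H (b, -a) :=
      (Measure.measurePreserving_neg (volume : Measure (En n))).quasiMeasurePreserving.ae step3
    have h2 := (Measure.quasiMeasurePreserving_fst (μ := (volume : Measure (En n)))
      (ν := (volume : Measure (En n)))).ae h1
    filter_upwards [h2] with w hw
    exact hw w.2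
  have mp1 : MeasurePreserving (fun w : En n × En n => (w.2, -w.1)) volume volume := by
    have h1 : MeasurePreserving (fun w : En n × En n => (w.2, w.1)) volume volume :=
      Measure.measurePreserving_swap
    have h2 : MeasurePreserving (fun w : En n × En n => (w.1, -w.2)) volume volume :=
      (MeasurePreserving.id (volume : Measure (En n))).prod (Measure.measurePreserving_neg (volume : Measure (En n)))
    exact h2.comp h1
  have mp2 : MeasurePreserving (fun w : En n × En n => (-w.2, w.1)) volume volume := by
    have h1 : MeasurePreserving (fun w : En n × En n => (w.2, w.1)) volume volume :=
      Measure.measurePreserving_swap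
    have h2 : MeasurePreserving (fun w : En n × En n => (-w.1, w.2)) volume volume :=
      (Measure.measurePreserving_neg (volume : Measure (En n))).prod (MeasurePreserving.id (volume : Measure (En n)))
    exact h2.comp h1
  have step5 := benV hn H hHi hs ?_
  · have h6 : ∀ᵐ w : En n × En n, H (w.2, -w.1) = 0 := by
      filter_upwards [step4, step5] with w h1 h2
      rw [← h1, h2]
    have h7 := mp2.quasiMeasurePreserving.ae h6
    filter_upwards [h7] with z hz
    rw [neg_neg] at hz
    exact hz
  · have h6 : {w : En n × En n | ∫ z : En n × En n, eV (-w.1) z.1 * eV (-w.2) z.2 * H z ≠ 0}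
        ≤ᵐ[volume] (fun w : En n × En n => (w.2, -w.1)) ⁻¹' (Function.support H) := by
      filter_upwards [step4] with w hw hw2
      change H (w.2, -w.1) ≠ 0
      rw [← hw]; exact hw2
    refine (measure_mono_ae h6).trans_lt ?_
    rw [mp1.measure_preimage hHm.measurableSet_support.nullMeasurableSet]
    exact hs
end

section
variable {W : Type*} [NormedAddCommGroup W] [NormedSpace ℝ W] [FiniteDimensional ℝ W]
  [MeasureSpace W] [BorelSpace W] [(volume : Measure W).IsAddHaarMeasure]

lemma prodzero_meas {F G : W → ℂ} (hF : StronglyMeasurable F) (hG : StronglyMeasurable G) :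
    MeasurableSet {p : W × W | F (p.2 + p.1) * G (p.2 - p.1) = 0} := by
  have := FiniteDimensional.proper_real W
  have h1 : StronglyMeasurable (fun p : W × W => F (p.2 + p.1) * G (p.2 - p.1)) :=
    (hF.comp_measurable (by fun_prop)).mul (hG.comp_measurable (by fun_prop))
  exact measurableSet_eq_fun h1.measurable measurable_const

lemma prodzero {F G : W → ℂ} (hF : StronglyMeasurable F) (hG : StronglyMeasurable G)
    (h : ∀ᵐ s, ∀ᵐ m, F (m + s) * G (m - s) = 0) : (∀ᵐ u, F u = 0) ∨ (∀ᵐ v, G v = 0) := by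
  have := FiniteDimensional.proper_real W
  have h1 : ∀ᵐ p : W × W, F (p.2 + p.1) * G (p.2 - p.1) = 0 :=
    (Measure.ae_prod_iff_ae_ae (prodzero_meas hF hG)).mpr h
  have h2 := Lae (fun q : W × W => F q.1 * G q.2 = 0) h1
  have h3 : ∀ᵐ u, ∀ᵐ v, F u * G v = 0 := Measure.ae_ae_of_ae_prod h2
  by_cases hu : ∀ᵐ u, F u = 0
  · exact Or.inl hu
  · right
    obtain ⟨u, hu1, hu2⟩ := ((Filter.not_eventually.mp hu).and_eventually h3).exists
    filter_upwards [hu2] with v hv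
    exact (mul_eq_zero.mp hv).resolve_left hu1

lemma prodzero' {F G : W → ℂ} (hF : StronglyMeasurable F) (hG : StronglyMeasurable G)
    (h : ∀ m, ∀ᵐ s, F (m + s) * G (m - s) = 0) : (∀ᵐ u, F u = 0) ∨ (∀ᵐ v, G v = 0) := by
  refine prodzero hF hG ((Measure.ae_ae_comm ?_).mpr (ae_of_all _ h))
  exact prodzero_meas hF hG
end

section
variable {n : ℕ}

lemma BB_shift (f g : En n → ℂ) (p q : En n) (z : En n × En n) :
    BB (fun ξ => eV (-((1 / 4 : ℝ) • p)) ξ * f (ξ + q)) (fun ξ => eV (-((1 / 4 : ℝ) • p)) ξ * g (ξ - q)) z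
      = BB f g ((p, q) + z) := by
  unfold BB
  congr 1; ext ξ
  have h1 : eV (-((1 / 2 : ℝ) • ((p, q) + z).1)) ξ = eV (-((1 / 2 : ℝ) • z.1)) ξ *
      (eV (-((1 / 4 : ℝ) • p)) (ξ + z.2) * eV (-((1 / 4 : ℝ) • p)) (ξ - z.2)) := by
    rw [← eV_add_right, eV_comm _ (ξ + z.2 + (ξ - z.2)),
      show ξ + z.2 + (ξ - z.2) = ξ + ξ by abel, eV_add_left, eV_comm ξ, ← eV_add_left, ← eV_add_left]
    congr 1
    simp only [Prod.fst_add]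
    module
  rw [h1]
  simp only [Prod.snd_add]
  rw [show ξ + (q + z.2) = ξ + z.2 + q by abel, show ξ - (q + z.2) = ξ - z.2 - q by abel]
  ring

lemma eV_mul_memLp (a : En n) {u : En n → ℂ} (hu : MemLp u 2) :
    MemLp (fun ξ => eV a ξ * u ξ) 2 := by
  refine hu.of_le_mul (c := 1) ((eV_cont a).aestronglyMeasurable.mul hu.1) ?_
  filter_upwards with x
  rw [norm_mul, eV_norm]

lemma Bzero (hn : 1 ≤ n) {f g : En n → ℂ} (hf : StronglyMeasurable f) (hg : StronglyMeasurable g)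
    (hf2 : MemLp f 2) (hg2 : MemLp g 2) (hfin : volume {z | BB f g z ≠ 0} < ⊤) :
    ∀ᵐ z, BB f g z = 0 := by
  have : (volume : Measure (En n × En n)).IsAddHaarMeasure :=
    inferInstanceAs (((volume : Measure (En n)).prod (volume : Measure (En n))).IsAddHaarMeasure)
  have hB := BB_meas hf hg
  have key : ∀ m : En n × En n, ∀ᵐ s, BB f g (m + s) * BB f g (m - s) = 0 := by
    rintro ⟨p, q⟩
    have h1 := Hzero hn (f := fun ξ => eV (-((1 / 4 : ℝ) • p)) ξ * f (ξ + q))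
      (g := fun ξ => eV (-((1 / 4 : ℝ) • p)) ξ * g (ξ - q))
      ((eV_cont _).stronglyMeasurable.mul (hf.comp_measurable (by fun_prop)))
      ((eV_cont _).stronglyMeasurable.mul (hg.comp_measurable (by fun_prop)))
      (eV_mul_memLp _ (hf2.comp_measurePreserving (measurePreserving_add_right volume q)))
      (eV_mul_memLp _ (hg2.comp_measurePreserving (measurePreserving_sub_right volume q))) ?_
    · simp_rw [BB_shift] at h1
      filter_upwards [h1] with s hs
      rw [sub_eq_add_neg]; exact hs
    · simp_rw [BB_shift]
      have h2 : {z | BB f g ((p, q) + z) ≠ 0} = (fun z => (p, q) + z) ⁻¹' {z | BB f g z ≠ 0} := rfl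
      rw [h2, measure_preimage_add]
      exact hfin
  rcases prodzero' hB hB key with h | h <;> exact h

lemma fgzero {f g : En n → ℂ} (hf : StronglyMeasurable f) (hg : StronglyMeasurable g)
    (hf2 : MemLp f 2) (hg2 : MemLp g 2) (h : ∀ᵐ z, BB f g z = 0) :
    (∀ᵐ u, f u = 0) ∨ (∀ᵐ v, g v = 0) := by
  have hB := BB_meas hf hg
  have h1 : ∀ᵐ x, ∀ᵐ y, BB f g (x, y) = 0 := Measure.ae_ae_of_ae_prod h
  have h2 : ∀ᵐ y, ∀ᵐ x, BB f g (x, y) = 0 := by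
    refine (Measure.ae_ae_comm ?_).mp h1
    exact measurableSet_eq_fun hB.measurable measurable_const
  refine prodzero hf hg ?_
  filter_upwards [h2] with y hy
  have h3 : ∀ᵐ x, ∫ ξ, eV (-x) ξ * (f (ξ + y) * g (ξ - y)) = 0 := by
    have h4 : ∀ᵐ x, BB f g ((2 : ℝ) • x, y) = 0 := by
      rw [ae_iff] at hy ⊢
      have := Measure.addHaar_preimage_smul (volume : Measure (En n)) (two_ne_zero (α := ℝ))
        {a | ¬ BB f g (a, y) = 0}
      rw [hy, mul_zero] at this
      exact this
    filter_upwards [h4] with x hx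
    rw [← hx]
    unfold BB
    congr 1; ext ξ
    simp [smul_smul]
  have h5 : Integrable (fun x => ∫ ξ, eV (-x) ξ * (f (ξ + y) * g (ξ - y))) :=
    (integrable_zero _ _ _).congr (by filter_upwards [h3] with x hx; exact hx.symm)
  have h6 := inv_ae _ (G_int hf2 hg2 y) h5
  filter_upwards [h6] with m hm
  rw [← hm]
  refine integral_eq_zero_of_ae ?_
  filter_upwards [h3] with x hx
  rw [hx, mul_zero]; rfl

lemma BB_congr {f g f' g' : En n → ℂ} (hf : f =ᵐ[volume] f') (hg : g =ᵐ[volume] g') (z : En n × En n) :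
    BB f g z = BB f' g' z := by
  unfold BB
  refine integral_congr_ae ?_
  have h1 := (measurePreserving_add_right (volume : Measure (En n)) z.2).quasiMeasurePreserving.ae hf
  have h2 := (measurePreserving_sub_right (volume : Measure (En n)) z.2).quasiMeasurePreserving.ae hg
  filter_upwards [h1, h2] with ξ a b
  rw [a, b]

theorem BB_main (hn : 1 ≤ n) {f g : En n → ℂ} (hf : MemLp f 2) (hg : MemLp g 2)
    (hfin : volume {z | BB f g z ≠ 0} < ⊤) (z : En n × En n) : BB f g z = 0 := by
  have ef := hf.1.ae_eq_mk
  have eg := hg.1.ae_eq_mk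
  have hz := BB_congr ef eg
  simp_rw [hz] at hfin ⊢
  have hf' := hf.ae_eq ef
  have hg' := hg.ae_eq eg
  have sf := hf.1.stronglyMeasurable_mk
  have sg := hg.1.stronglyMeasurable_mk
  rcases fgzero sf sg hf' hg' (Bzero hn sf sg hf' hg' hfin) with h | h
  · rw [BB_congr (f' := fun _ => 0) h (Filter.EventuallyEq.refl _ _)]
    simp [BB]
  · rw [BB_congr (g' := fun _ => 0) (Filter.EventuallyEq.refl _ _) h]
    simp [BB]
end

def AA {n : ℕ} (d : Fin n → ℝ) (hd : ∀ j, 0 < d j) : (En n × En n) ≃ₗ[ℝ] (En n × En n) where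
  toFun z := (WithLp.toLp 2 (fun j => -(Real.pi * z.1 j / d j)), (2 : ℝ) • z.2)
  invFun z := (WithLp.toLp 2 (fun j => -(d j * z.1 j / Real.pi)), (1 / 2 : ℝ) • z.2)
  left_inv z := by
    have := fun j => (hd j).ne'
    refine Prod.ext ?_ ?_
    · ext j
      simp
      field_simp [this j]
    · simp [smul_smul]
  right_inv z := by
    have := fun j => (hd j).ne'
    refine Prod.ext ?_ ?_
    · ext j
      simp
      field_simp [this j]
    · simp [smul_smul]
  map_add' z w := by
    refine Prod.ext ?_ ?_
    · ext j
      simp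
      ring
    · simp
  map_smul' c z := by
    refine Prod.ext ?_ ?_
    · ext j
      simp
      ring
    · simp [smul_smul, mul_comm]

lemma Td_eq {n : ℕ} (d : Fin n → ℝ) (hd : ∀ j, 0 < d j) (φ ψ : En n → ℂ) (z : En n × En n) :
    Td d φ ψ (AA d hd z) = BB φ (fun ξ => (starRingEnd ℂ) (ψ ξ)) z := by
  unfold Td BB
  rw [← integral_sub_right_eq_self _ z.2]
  congr 1; ext ξ
  unfold piD
  have h1 : (AA d hd z).2 = (2 : ℝ) • z.2 := rfl
  have h2 : ∀ j, (AA d hd z).1 j = -(Real.pi * z.1 j / d j) := fun j => rfl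
  rw [show ξ - z.2 + (AA d hd z).2 = ξ + z.2 by rw [h1]; module, mul_assoc]
  congr 1
  unfold eV eC
  rw [mul_comm Complex.I]
  congr 3
  rw [Finset.mul_sum]
  refine Finset.sum_congr rfl fun j _ => ?_
  rw [h1, h2]
  have := (hd j).ne'
  simp
  field_simp
  ring

/-- Let φ, ψ ∈ L²(ℝⁿ) and F = T_d(φ,ψ). If {v ∈ ℝ²ⁿ : F(v) ≠ 0} has
finite Lebesgue measure, then F vanishes identically. -/
theorem stmt8 {n : ℕ} (hn : 1 ≤ n) (d : Fin n → ℝ) (hd : ∀ j, 0 < d j)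
    (φ ψ : En n → ℂ)
    (hφ : MemLp φ 2 (volume : Measure (En n)))
    (hψ : MemLp ψ 2 (volume : Measure (En n)))
    (hfin : volume {v : En n × En n | Td d φ ψ v ≠ 0} < ⊤) :
    ∀ v : En n × En n, Td d φ ψ v = 0 := by
  have : (volume : Measure (En n × En n)).IsAddHaarMeasure :=
    inferInstanceAs (((volume : Measure (En n)).prod (volume : Measure (En n))).IsAddHaarMeasure)
  have hB : volume {z | BB φ (fun ξ => (starRingEnd ℂ) (ψ ξ)) z ≠ 0} < ⊤ := by
    simp_rw [← Td_eq d hd]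
    have hdet : LinearMap.det (AA d hd : (En n × En n) →ₗ[ℝ] (En n × En n)) ≠ 0 :=
      (AA d hd).isUnit_det'.ne_zero
    have h1 := Measure.addHaar_preimage_linearMap (volume : Measure (En n × En n)) hdet
      {v : En n × En n | Td d φ ψ v ≠ 0}
    refine (le_of_eq h1).trans_lt ?_
    exact ENNReal.mul_lt_top ENNReal.ofReal_lt_top hfin
  intro v
  obtain ⟨z, rfl⟩ := (AA d hd).surjective v
  rw [Td_eq]
  exact BB_main hn hφ hψ.star hB z
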